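/- Let x and y be irrational real numbers with continued fraction partial quotient sequences (a_n) and (b_n) respectively. Then there exists a matrix M = !![α, β; γ, δ] ∈ GL(2, ℤ) with y = (α x + β)/(γ x + δ) if and only if the two continued fraction expansions have the same tail up to a shift, i.e. there exist k, m ∈ ℕ such that a_{k+n} = b_{m+n} for all n ∈ ℕ. -/

import Mathlib

/-- The orbit of `x` under the Gauss (continued fraction) map:
`x₀ = x`, `x_{n+1} = 1/(xₙ - ⌊xₙ⌋)`. -/
noncomputable def cfracAux (x : ℝ) : ℕ → ℝ
  | 0 => x
  | n + 1 => 1 / Int.fract (cfracAux x n)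

/-- The continued fraction partial quotient sequence of `x`:
`a n = ⌊xₙ⌋` in the standard continued fraction algorithm. -/
noncomputable def cfrac (x : ℝ) (n : ℕ) : ℤ := ⌊cfracAux x n⌋

theorem cfracAux_add (x : ℝ) (k n : ℕ) :
    cfracAux x (k + n) = cfracAux (cfracAux x k) n := by
  induction n with
  | zero => rfl
  | succ n ih => rw [← add_assoc, cfracAux, cfracAux, ih]

theorem irrational_fract {x : ℝ} (hx : Irrational x) : Irrational (Int.fract x) :=
  hx.sub_intCast ⌊x⌋

theorem irrational_cfracAux {x : ℝ} (hx : Irrational x) (n : ℕ) : Irrational (cfracAux x n) := by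
  induction n with
  | zero => exact hx
  | succ n ih =>
    rw [cfracAux, one_div]
    exact (irrational_fract ih).inv

theorem fract_pos_of_irrational {x : ℝ} (hx : Irrational x) : 0 < Int.fract x :=
  lt_of_le_of_ne (Int.fract_nonneg x) (irrational_fract hx).ne_zero.symm

theorem one_lt_cfracAux_one {x : ℝ} (hx : Irrational x) : 1 < cfracAux x 1 :=
  one_lt_one_div (fract_pos_of_irrational hx) (Int.fract_lt_one x)

theorem eq_cfrac_zero_add_inv (x : ℝ) : x = cfrac x 0 + (cfracAux x 1)⁻¹ := by
  simp [cfrac, cfracAux]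

theorem cfrac_cfracAux (x : ℝ) (k n : ℕ) : cfrac (cfracAux x k) n = cfrac x (k + n) := by
  rw [cfrac, cfrac, cfracAux_add]

/-- The product of the first two iterates is at least `2`, since `x₁ x₂ = a₁ x₂ + 1`. -/
theorem two_le_cfracAux_mul {x : ℝ} (hx : Irrational x) :
    2 ≤ cfracAux x 1 * cfracAux x 2 := by
  have h1 := one_lt_cfracAux_one hx
  have h2 : 1 < cfracAux x 2 := by
    rw [cfracAux_add x 1 1]
    exact one_lt_cfracAux_one (irrational_cfracAux hx 1)
  have h := eq_cfrac_zero_add_inv (cfracAux x 1)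
  rw [← cfracAux_add x 1 1] at h
  have ha : (1 : ℝ) ≤ cfrac (cfracAux x 1) 0 := by
    exact_mod_cast Int.le_floor.2 (by simpa [cfracAux] using h1.le)
  have hmul : cfracAux x 1 * cfracAux x 2
      = cfrac (cfracAux x 1) 0 * cfracAux x 2 + 1 := by
    conv_lhs => rw [h]
    rw [add_mul, inv_mul_cancel₀ (by positivity)]
  nlinarith

theorem sub_eq_of_cfrac_zero_eq {x y : ℝ} (hx : Irrational x) (hy : Irrational y)
    (h : cfrac x 0 = cfrac y 0) :
    x - y = (cfracAux y 1 - cfracAux x 1) / (cfracAux x 1 * cfracAux y 1) := by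
  have hx0 := (irrational_cfracAux hx 1).ne_zero
  have hy0 := (irrational_cfracAux hy 1).ne_zero
  have hsub : x - y = (cfracAux x 1)⁻¹ - (cfracAux y 1)⁻¹ := by
    have ex := eq_cfrac_zero_add_inv x
    rw [h] at ex
    linarith [eq_cfrac_zero_add_inv y]
  rw [hsub, inv_sub_inv hx0 hy0]

theorem abs_sub_le_of_cfrac_eq (N : ℕ) {x y : ℝ} (hx : Irrational x) (hy : Irrational y)
    (h : ∀ n, cfrac x n = cfrac y n) : |x - y| ≤ (1 / 4) ^ N := by
  induction N generalizing x y with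
  | zero =>
    rw [pow_zero]
    exact (Int.abs_sub_lt_one_of_floor_eq_floor (h 0)).le
  | succ N ih =>
    have ih2 := ih (irrational_cfracAux hx 2) (irrational_cfracAux hy 2) fun n => by
      rw [cfrac_cfracAux, cfrac_cfracAux, h]
    have e1 := sub_eq_of_cfrac_zero_eq hx hy (h 0)
    have e2 := sub_eq_of_cfrac_zero_eq (irrational_cfracAux hx 1) (irrational_cfracAux hy 1)
      (by rw [cfrac_cfracAux, cfrac_cfracAux, h])
    rw [← cfracAux_add x 1 1, ← cfracAux_add y 1 1] at e2
    have px := two_le_cfracAux_mul hx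
    have py := two_le_cfracAux_mul hy
    have e : x - y = (cfracAux x 2 - cfracAux y 2) /
        ((cfracAux x 1 * cfracAux x 2) * (cfracAux y 1 * cfracAux y 2)) := by
      rw [e1, ← neg_sub, e2, ← neg_div, neg_sub, div_div]
      congr 1
      ring
    have hp : 4 ≤ (cfracAux x 1 * cfracAux x 2) * (cfracAux y 1 * cfracAux y 2) := by
      nlinarith
    rw [e, abs_div, abs_of_pos (lt_of_lt_of_le four_pos hp), div_le_iff₀ (by linarith), pow_succ]
    have : (0 : ℝ) < (1 / 4) ^ N := by positivity
    nlinarith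

theorem eq_of_cfrac_eq {x y : ℝ} (hx : Irrational x) (hy : Irrational y)
    (h : ∀ n, cfrac x n = cfrac y n) : x = y := by
  have h0 : |x - y| ≤ 0 :=
    ge_of_tendsto' (tendsto_pow_atTop_nhds_zero_of_lt_one (by norm_num) (by norm_num))
      fun N => abs_sub_le_of_cfrac_eq N hx hy h
  exact sub_eq_zero.1 (abs_nonpos_iff.1 h0)

/-- The Gauss orbits of `x` and `y` eventually merge. -/
def OrbitsMerge (x y : ℝ) : Prop := ∃ k m : ℕ, cfracAux x k = cfracAux y m

namespace OrbitsMerge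

theorem symm {x y : ℝ} : OrbitsMerge x y → OrbitsMerge y x :=
  fun ⟨k, m, h⟩ => ⟨m, k, h.symm⟩

theorem trans {x y z : ℝ} : OrbitsMerge x y → OrbitsMerge y z → OrbitsMerge x z := by
  rintro ⟨k, m, h⟩ ⟨k', m', h'⟩
  refine ⟨k + k', m' + m, ?_⟩
  rw [cfracAux_add, h, ← cfracAux_add, cfracAux_add z, ← h', ← cfracAux_add, add_comm]

theorem add_int (x : ℝ) (n : ℤ) : OrbitsMerge x (x + n) :=
  ⟨1, 1, by simp [cfracAux]⟩

theorem inv_of_pos {x : ℝ} (h0 : 0 < x) (h1 : x ≠ 1) : OrbitsMerge x x⁻¹ := by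
  have key : ∀ z : ℝ, 1 < z → OrbitsMerge z z⁻¹ := fun z hz => by
    refine ⟨0, 1, ?_⟩
    have hf : Int.fract z⁻¹ = z⁻¹ :=
      Int.fract_eq_self.2 ⟨by positivity, inv_lt_one_of_one_lt₀ hz⟩
    simp [cfracAux, hf]
  rcases lt_or_gt_of_ne h1 with h | h
  · simpa using (key x⁻¹ ((one_lt_inv₀ h0).2 h)).symm
  · exact key x h

theorem one_sub_of_lt_half {f : ℝ} (h0 : 0 < f) (h1 : f < 1 / 2) : OrbitsMerge f (1 - f) := by
  have hf : 0 < 1 - f := by linarith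
  have a : OrbitsMerge (1 - f) (1 - f)⁻¹ := inv_of_pos hf (by linarith)
  have b : OrbitsMerge (f / (1 - f)) (1 - f)⁻¹ := by
    convert add_int (f / (1 - f)) 1 using 1
    field_simp
    push_cast
    ring
  have c : OrbitsMerge (f / (1 - f)) (f / (1 - f))⁻¹ :=
    inv_of_pos (by positivity) (ne_of_lt ((div_lt_one hf).2 (by linarith)))
  have d : OrbitsMerge f⁻¹ (f / (1 - f))⁻¹ := by
    convert add_int f⁻¹ (-1) using 1
    field_simp
    push_cast
    ring
  exact (inv_of_pos h0 (by linarith)).trans (d.trans (c.symm.trans (b.trans a.symm)))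

theorem neg {x : ℝ} (hx : Irrational x) : OrbitsMerge x (-x) := by
  have h0 := fract_pos_of_irrational hx
  have h1 := Int.fract_lt_one x
  have hx' : OrbitsMerge (Int.fract x) x := by
    simpa using add_int (Int.fract x) ⌊x⌋
  have hn : OrbitsMerge (1 - Int.fract x) (-x) := by
    convert add_int (1 - Int.fract x) (-⌊x⌋ - 1) using 1
    rw [Int.fract]
    push_cast
    ring
  have hne : Int.fract x ≠ 1 / 2 := fun h =>
    irrational_fract hx ⟨1 / 2, by rw [h]; norm_num⟩
  have hm : OrbitsMerge (Int.fract x) (1 - Int.fract x) := by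
    rcases lt_or_gt_of_ne hne with h | h
    · exact one_sub_of_lt_half h0 h
    · simpa using (one_sub_of_lt_half (f := 1 - Int.fract x) (by linarith) (by linarith)).symm
  exact hx'.symm.trans (hm.trans hn)

theorem inv {x : ℝ} (hx : Irrational x) : OrbitsMerge x x⁻¹ := by
  rcases lt_or_gt_of_ne hx.ne_zero with h | h
  · have hi : OrbitsMerge (-x) (-x)⁻¹ :=
      inv_of_pos (by linarith) fun h' => hx.neg.ne_one h'
    rw [inv_neg] at hi
    exact (neg hx).trans (hi.trans (neg hx.inv).symm)
  · exact inv_of_pos h hx.ne_one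

/-- Reduction of the matrix by the Euclidean algorithm on its first column. -/
theorem of_fractional_linear {x : ℝ} (hx : Irrational x) (N : ℕ) :
    ∀ {y : ℝ}, Irrational y → ∀ α β γ δ : ℤ, γ.natAbs = N →
      (α * δ - β * γ = 1 ∨ α * δ - β * γ = -1) →
      y = ((α : ℝ) * x + β) / ((γ : ℝ) * x + δ) → OrbitsMerge x y := by
  induction N using Nat.strong_induction_on with
  | _ N ih =>
  intro y hy α β γ δ hN hdet h
  by_cases hγ : γ = 0
  · subst hγ
    have hu : IsUnit (α * δ) := by
      rw [Int.isUnit_iff]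
      simpa using hdet
    obtain ⟨hα, hδ⟩ := IsUnit.mul_iff.1 hu
    rcases Int.isUnit_iff.1 hα with rfl | rfl <;> rcases Int.isUnit_iff.1 hδ with rfl | rfl
    · convert add_int x β using 1
      rw [h]; push_cast; ring
    · refine (neg hx).trans ?_
      convert add_int (-x) (-β) using 1
      rw [h]; push_cast; ring
    · refine (neg hx).trans ?_
      convert add_int (-x) β using 1
      rw [h]; push_cast; ring
    · convert add_int x (-β) using 1
      rw [h]; push_cast; ring
  · have hden : (γ : ℝ) * x + δ ≠ 0 := fun h0 => hy.ne_zero (by rw [h, h0, div_zero])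
    have hy' : Irrational (y - (α / γ : ℤ)) := hy.sub_intCast _
    have hα : (α : ℝ) = γ * (α / γ : ℤ) + (α % γ : ℤ) := by
      exact_mod_cast (Int.mul_ediv_add_emod α γ).symm
    have hlt : (α % γ).natAbs < N := by
      have := Int.emod_nonneg α hγ
      have h2 := Int.emod_lt_abs α hγ
      rw [Int.abs_eq_natAbs] at h2
      omega
    have hrec : OrbitsMerge x (y - (α / γ : ℤ))⁻¹ := by
      refine ih _ hlt hy'.inv γ δ (α % γ) (β - (α / γ) * δ) rfl ?_ ?_
      · have hd : γ * (β - (α / γ) * δ) - δ * (α % γ) = -(α * δ - β * γ) := by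
          linear_combination -δ * Int.mul_ediv_add_emod α γ
        rw [hd]
        rcases hdet with h1 | h1 <;> simp [h1]
      · rw [← inv_div]
        congr 1
        rw [h, hα, eq_div_iff hden, sub_mul, div_mul_cancel₀ _ hden]
        push_cast
        ring
    refine hrec.trans ((inv hy').symm.trans ?_)
    simpa using add_int (y - (α / γ : ℤ)) (α / γ)

end OrbitsMerge

/-- `y` is the image of `x` under some element of `GL(2, ℤ)`. -/
def IsFractionalLinearImage (x y : ℝ) : Prop :=
  ∃ α β γ δ : ℤ, (α * δ - β * γ = 1 ∨ α * δ - β * γ = -1) ∧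
    y = ((α : ℝ) * x + β) / ((γ : ℝ) * x + δ)

namespace IsFractionalLinearImage

theorem refl (x : ℝ) : IsFractionalLinearImage x x := ⟨1, 0, 0, 1, by simp, by simp⟩

theorem inv {x w : ℝ} : IsFractionalLinearImage x w → IsFractionalLinearImage x w⁻¹ := by
  rintro ⟨α, β, γ, δ, hdet, h⟩
  refine ⟨γ, δ, α, β, ?_, by rw [h, inv_div]⟩
  have hd : γ * β - δ * α = -(α * δ - β * γ) := by ring
  rw [hd]
  rcases hdet with h1 | h1 <;> simp [h1]

theorem add_int {x w : ℝ} (hw : w ≠ 0) (n : ℤ) :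
    IsFractionalLinearImage x w → IsFractionalLinearImage x (w + n) := by
  rintro ⟨α, β, γ, δ, hdet, h⟩
  have hden : (γ : ℝ) * x + δ ≠ 0 := fun h0 => hw (by rw [h, h0, div_zero])
  refine ⟨α + n * γ, β + n * δ, γ, δ, ?_, ?_⟩
  · convert hdet using 2 <;> ring
  · rw [h, div_add' _ _ _ hden]
    push_cast
    ring

theorem orbit {x w : ℝ} (hw : Irrational w) (h : IsFractionalLinearImage x w) (k : ℕ) :
    IsFractionalLinearImage x (cfracAux w k) := by
  induction k with
  | zero => exact h
  | succ k ih =>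
    rw [cfracAux, one_div, Int.fract]
    have := ih.add_int (irrational_cfracAux hw k).ne_zero (-⌊cfracAux w k⌋)
    push_cast at this
    exact this.inv

theorem of_orbit {x w : ℝ} (hw : Irrational w) (k : ℕ)
    (h : IsFractionalLinearImage x (cfracAux w k)) : IsFractionalLinearImage x w := by
  induction k with
  | zero => exact h
  | succ k ih =>
    refine ih ?_
    rw [cfracAux, one_div] at h
    have hf := irrational_fract (irrational_cfracAux hw k)
    have := h.inv.add_int (by simpa using hf.ne_zero) ⌊cfracAux w k⌋
    simpa using this

end IsFractionalLinearImage

/-- Two irrational reals `x, y` are related by a fractional linear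
transformation `y = (αx + β)/(γx + δ)` with `!![α, β; γ, δ] ∈ GL(2, ℤ)` (integer
entries, determinant `±1`) if and only if their continued fraction expansions have the
same tail up to a shift. -/
theorem stmt_17
    (x y : ℝ) (hx : Irrational x) (hy : Irrational y) :
    (∃ α β γ δ : ℤ, (α * δ - β * γ = 1 ∨ α * δ - β * γ = -1) ∧
        y = ((α : ℝ) * x + β) / ((γ : ℝ) * x + δ)) ↔
    (∃ k m : ℕ, ∀ n : ℕ, cfrac x (k + n) = cfrac y (m + n)) := by
  constructor
  · rintro ⟨α, β, γ, δ, hdet, h⟩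
    obtain ⟨k, m, hkm⟩ := OrbitsMerge.of_fractional_linear hx _ hy α β γ δ rfl hdet h
    exact ⟨k, m, fun n => by rw [← cfrac_cfracAux, hkm, cfrac_cfracAux]⟩
  · rintro ⟨k, m, h⟩
    have hkm : cfracAux x k = cfracAux y m :=
      eq_of_cfrac_eq (irrational_cfracAux hx k) (irrational_cfracAux hy m) fun n => by
        rw [cfrac_cfracAux, cfrac_cfracAux, h]
    refine IsFractionalLinearImage.of_orbit hy m ?_
    rw [← hkm]
    exact (IsFractionalLinearImage.refl x).orbit hx k
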